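/- Let X ⊆ ℙⁿ be a Zariski closed set defined over a number field k. If X_{ℚ̄} contains a (possibly singular) rational curve, then X is not xeric: there exist a finite extension L/k, a real number ε > 0, and a constant c > 0 such that N(X, L, T) ≥ c · T^ε for all sufficiently large T. -/

import Mathlib

noncomputable section

open MvPolynomial
open MvPolynomial

def vecHeight {K : Type} [Field K] [NumberField K] {N : ℕ} (x : Fin N → K) : ℝ :=
  (((FractionalIdeal.absNorm
        (∑ i, FractionalIdeal.spanSingleton
          (nonZeroDivisors (NumberField.RingOfIntegers K)) (x i)) : ℚ) : ℝ)⁻¹ *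
      ∏ w : NumberField.InfinitePlace K, (⨆ i, w (x i)) ^ w.mult) ^
    ((Module.finrank ℚ K : ℝ)⁻¹)

def projHeight {K : Type} [Field K] [NumberField K] {n : ℕ}
    (x : Projectivization K (Fin (n + 1) → K)) : ℝ :=
  vecHeight x.rep

/-! ### Projective zero loci, counting, sparsity -/

/-- The set of `L`-rational points of the Zariski closed subset of `ℙⁿ` cut out by the
set `S` of (homogeneous) polynomials with coefficients in `k`. -/
def projZeroLocus (k : Type) [CommRing k] {n : ℕ} (S : Set (MvPolynomial (Fin (n + 1)) k))
    (L : Type) [Field L] [Algebra k L] : Set (Projectivization L (Fin (n + 1) → L)) :=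
  {x | ∀ f ∈ S, eval x.rep (map (algebraMap k L) f) = 0}

/-- A set `S` of points (of projective space over a number field, say) is *sparse* with
respect to a height function `H` if for every `ε > 0` the number of points of `S` of
height at most `T` is `O_ε(T ^ ε)`. -/
def IsSparseWrt {P : Type} (S : Set P) (H : P → ℝ) : Prop :=
  ∀ ε : ℝ, 0 < ε → ∃ C : ℝ, 0 < C ∧ ∀ T : ℝ, 1 ≤ T →
    {x | x ∈ S ∧ H x ≤ T}.Finite ∧ ({x | x ∈ S ∧ H x ≤ T}.ncard : ℝ) ≤ C * T ^ ε

/-- Sparsity with respect to the standard projective Weil height. -/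
def IsSparse {L : Type} [Field L] [NumberField L] {n : ℕ}
    (S : Set (Projectivization L (Fin (n + 1) → L))) : Prop :=
  IsSparseWrt S projHeight

/-- The closed subset of `ℙⁿ` over a number field `k` cut out by `S` is *xeric* if its set
of `L`-rational points is sparse for every finite extension `L/k`. -/
def IsXeric (k : Type) [Field k] [NumberField k] {n : ℕ}
    (S : Set (MvPolynomial (Fin (n + 1)) k)) : Prop :=
  ∀ (L : Type) [Field L] [NumberField L] [Algebra k L] [FiniteDimensional k L],
    IsSparse (projZeroLocus k S L)

/-! ### Geometric irreducibility and smoothness, via equations -/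

/-- The closed subvariety of `ℙⁿ` cut out by `S` is geometrically integral (a
"geometrically irreducible variety"), expressed over a given algebraically closed
extension `K` of the ground field: the radical of the homogeneous ideal generated by `S`
is prime, and the corresponding cone has a nonzero point. -/
def GeomIntegralOver (k K : Type) [Field k] [Field K] [Algebra k K] {n : ℕ}
    (S : Set (MvPolynomial (Fin (n + 1)) k)) : Prop :=
  (Ideal.span ((map (algebraMap k K)) '' S)).radical.IsPrime ∧
    ∃ x : Fin (n + 1) → K, x ≠ 0 ∧ ∀ f ∈ S, eval x (map (algebraMap k K) f) = 0

/-- Smoothness (of pure dimension `d`) of the closed subvariety of `ℙⁿ` cut out by `S`,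
via the Jacobian criterion: at every nonzero point `x` of the affine cone over an
algebraically closed extension `K`, the space spanned by the gradients of the elements of
the homogeneous ideal of `X` has rank `n - d`. -/
def SmoothOfDimOver (k K : Type) [Field k] [Field K] [Algebra k K] {n : ℕ}
    (S : Set (MvPolynomial (Fin (n + 1)) k)) (d : ℕ) : Prop :=
  ∀ x : Fin (n + 1) → K, x ≠ 0 →
    (∀ f ∈ S, eval x (map (algebraMap k K) f) = 0) →
    Module.finrank K
      (Submodule.span K
        {g : Fin (n + 1) → K |
          ∃ f ∈ Ideal.span ((map (algebraMap k K)) '' S),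
            g = fun j => eval x (pderiv j f)}) = n - d
open MvPolynomial

/-! ### Morphisms of projective varieties, given by finitely many polynomial charts -/

/-- Data describing a morphism from a closed subvariety of `ℙᵐ` to `ℙⁿ`: finitely many
"charts", each of which is an `(n+1)`-tuple of homogeneous polynomials of a common
degree in the `m+1` homogeneous coordinates. -/
structure ChartMap (k : Type) [CommRing k] (m n : ℕ) where
  numCharts : ℕ
  F : Fin numCharts → Fin (n + 1) → MvPolynomial (Fin (m + 1)) k
  deg : Fin numCharts → ℕ
  homog : ∀ c i, (F c i).IsHomogeneous (deg c)

/-- Evaluation of the chart `c` of a `ChartMap` on a coordinate vector with entries in a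
`k`-algebra `A`. -/
def ChartMap.evalVec {k : Type} [CommRing k] {m n : ℕ} (Φ : ChartMap k m n)
    {A : Type} [CommRing A] [Algebra k A] (c : Fin Φ.numCharts) (y : Fin (m + 1) → A) :
    Fin (n + 1) → A :=
  fun i => eval y (map (algebraMap k A) (Φ.F c i))

/-- Base change of the polynomial data of a chart map along `k → K`. -/
def ChartMap.baseChange {k K : Type} [CommRing k] [CommRing K] [Algebra k K] {m n : ℕ}
    (Φ : ChartMap k m n) : ChartMap K m n where
  numCharts := Φ.numCharts
  F := fun c i => map (algebraMap k K) (Φ.F c i)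
  deg := Φ.deg
  homog := fun c i => (Φ.homog c i).map _

/-- The `A`-points of the closed subscheme of `ℙⁿ` cut out by `S`, for a (local)
`k`-algebra `A`, described by coordinate vectors: vectors, one of whose coordinates is a
unit, on which all the equations vanish.  (Two such vectors describe the same `A`-point
iff they differ by a unit scalar, see `unitEquiv`.) -/
def ringPoints (k : Type) [CommRing k] {n : ℕ} (S : Set (MvPolynomial (Fin (n + 1)) k))
    (A : Type) [CommRing A] [Algebra k A] : Set (Fin (n + 1) → A) :=
  {a | (∃ i, IsUnit (a i)) ∧ ∀ f ∈ S, eval a (map (algebraMap k A) f) = 0}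

/-- Two coordinate vectors describe the same point iff they differ by a unit scalar. -/
def unitEquiv {A : Type} [CommRing A] {N : ℕ} (a b : Fin N → A) : Prop :=
  ∃ u : Aˣ, b = fun i => (u : A) * a i

/-- The property that the chart data `Φ` defines a morphism from the closed subvariety
`Y ⊆ ℙᵐ` cut out by `SY` to the closed subvariety `X ⊆ ℙⁿ` cut out by `SX`:  on the
points of `Y` with values in any local `k`-algebra `A`, some chart is defined (has a unit
coordinate), any two defined charts agree up to a unit scalar, and the image satisfies
the equations of `X`.  (The functor of points on local rings determines a morphism of
  schemes, and every morphism of quasi-projective varieties arises this way.) -/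
structure IsChartMorphism (k : Type) [Field k] {m n : ℕ} (Φ : ChartMap k m n)
    (SY : Set (MvPolynomial (Fin (m + 1)) k)) (SX : Set (MvPolynomial (Fin (n + 1)) k)) :
    Prop where
  total : ∀ (A : Type) [CommRing A] [IsLocalRing A] [Algebra k A],
    ∀ a ∈ ringPoints k SY A, ∃ c i, IsUnit (Φ.evalVec c a i)
  compat : ∀ (A : Type) [CommRing A] [IsLocalRing A] [Algebra k A],
    ∀ a ∈ ringPoints k SY A, ∀ c c', (∃ i, IsUnit (Φ.evalVec c a i)) →
      (∃ i, IsUnit (Φ.evalVec c' a i)) → unitEquiv (Φ.evalVec c a) (Φ.evalVec c' a)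
  mapsInto : ∀ (A : Type) [CommRing A] [IsLocalRing A] [Algebra k A],
    ∀ a ∈ ringPoints k SY A, ∀ c, (∃ i, IsUnit (Φ.evalVec c a i)) →
      Φ.evalVec c a ∈ ringPoints k SX A

/-- The graph of the map induced by the chart data `Φ` on projective points over a field
`L`: `z` is the image of `x` if some chart of `Φ` is nonzero at (a representative of) `x`
and `z` is the corresponding projective point. -/
def chartImage {k L : Type} [Field k] [Field L] [Algebra k L] {m n : ℕ}
    (Φ : ChartMap k m n) (x : Projectivization L (Fin (m + 1) → L))
    (z : Projectivization L (Fin (n + 1) → L)) : Prop :=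
  ∃ c, ∃ h : Φ.evalVec c x.rep ≠ 0, z = Projectivization.mk L (Φ.evalVec c x.rep) h

/-! ### Finite étale morphisms, concretely -/

/-- The set of coordinate vectors of `A`-points of `Y` lying (up to a unit scalar, as
they must) over the `A`-point of `X` with coordinate vector `b`, under the map given by
the chart data `Φ`. -/
def fiberOver (k : Type) [Field k] {m n : ℕ} (Φ : ChartMap k m n)
    (SY : Set (MvPolynomial (Fin (m + 1)) k)) (A : Type) [CommRing A] [Algebra k A]
    (b : Fin (n + 1) → A) : Set (Fin (m + 1) → A) :=
  {a | a ∈ ringPoints k SY A ∧ ∃ c, (∃ i, IsUnit (Φ.evalVec c a i)) ∧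
    unitEquiv (Φ.evalVec c a) b}

/-- A set of coordinate vectors contains exactly `d` points up to unit scaling. -/
def HasExactlyPoints {A : Type} [CommRing A] {N : ℕ} (s : Set (Fin N → A)) (d : ℕ) :
    Prop :=
  ∃ r : Fin d → (Fin N → A), (∀ j, r j ∈ s) ∧
    (∀ j j', unitEquiv (r j) (r j') → j = j') ∧ ∀ a ∈ s, ∃ j, unitEquiv a (r j)

/-- The morphism `Y → X` given by the chart data `Φ` is finite étale of degree `d`:
over every point of `X` with values in a local Artinian `k`-algebra with algebraically
closed residue field, the fiber consists of exactly `d` points.  (For a morphism of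
projective varieties over a field of characteristic `0` this characterizes finite étale
morphisms of degree `d`.) -/
def IsFiniteEtaleOfDegree (k : Type) [Field k] {m n : ℕ} (Φ : ChartMap k m n)
    (SY : Set (MvPolynomial (Fin (m + 1)) k)) (SX : Set (MvPolynomial (Fin (n + 1)) k))
    (d : ℕ) : Prop :=
  ∀ (A : Type) [CommRing A] [IsLocalRing A] [IsArtinianRing A] [Algebra k A],
    IsAlgClosed (IsLocalRing.ResidueField A) →
    ∀ b ∈ ringPoints k SX A, HasExactlyPoints (fiberOver k Φ SY A b) d

/-- Finite étale (of some positive degree). -/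
def IsFiniteEtaleMor (k : Type) [Field k] {m n : ℕ} (Φ : ChartMap k m n)
    (SY : Set (MvPolynomial (Fin (m + 1)) k)) (SX : Set (MvPolynomial (Fin (n + 1)) k)) :
    Prop :=
  ∃ d : ℕ, 0 < d ∧ IsFiniteEtaleOfDegree k Φ SY SX d

/-! ### Rational curves -/

/-- Data for a morphism `ℙ¹ → ℙⁿ`: an `(n+1)`-tuple of binary forms of a common degree. -/
structure RatCurveData (K : Type) [CommRing K] (n : ℕ) where
  d : ℕ
  P : Fin (n + 1) → MvPolynomial (Fin 2) K
  homog : ∀ i, (P i).IsHomogeneous d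

/-- Evaluation of the tuple of binary forms at `(s, t)`. -/
def RatCurveData.evalAt {K : Type} [CommRing K] {n : ℕ} (Γ : RatCurveData K n)
    (s t : K) : Fin (n + 1) → K :=
  fun i => eval ![s, t] (Γ.P i)

/-- A subset `C` of `ℙⁿ(K)`, `K` algebraically closed, is a (possibly singular) rational
curve if it is the image of a non-constant morphism `ℙ¹ → ℙⁿ` (such an image is
automatically an integral closed curve). -/
def IsRationalCurve (K : Type) [Field K] {n : ℕ}
    (C : Set (Projectivization K (Fin (n + 1) → K))) : Prop :=
  ∃ Γ : RatCurveData K n,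
    (∀ s t : K, ¬(s = 0 ∧ t = 0) → Γ.evalAt s t ≠ 0) ∧
    (∃ s t s' t' : K, ¬(s = 0 ∧ t = 0) ∧ ¬(s' = 0 ∧ t' = 0) ∧
      ∀ u : K, Γ.evalAt s' t' ≠ u • Γ.evalAt s t) ∧
    C = {z | ∃ s t : K, ∃ h : Γ.evalAt s t ≠ 0, z = Projectivization.mk K (Γ.evalAt s t) h}

/-- A bundled finite extension of the number field `k` (itself a number field). -/
structure FiniteExtensionOf (k : Type) [Field k] [NumberField k] where
  carrier : Type
  [field : Field carrier]
  [alg : Algebra k carrier]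
  [fd : FiniteDimensional k carrier]
  [nf : NumberField carrier]

attribute [instance] FiniteExtensionOf.field FiniteExtensionOf.alg
  FiniteExtensionOf.fd FiniteExtensionOf.nf

/-! ### Comparison with the heights of Mathlib -/

section Height

open NumberField

variable {K : Type} [Field K] [NumberField K]

lemma prod_infinitePlace_iSup_smul {N : ℕ} (c : K) (x : Fin N → K) :
    ∏ w : InfinitePlace K, (⨆ i, w ((c • x) i)) ^ w.mult =
      |(Algebra.norm ℚ c : ℝ)| * ∏ w : InfinitePlace K, (⨆ i, w (x i)) ^ w.mult := by
  have hc := InfinitePlace.prod_eq_abs_norm c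
  push_cast at hc
  rw [← hc, ← Finset.prod_mul_distrib]
  refine Finset.prod_congr rfl fun w _ ↦ ?_
  rw [← mul_pow, Real.mul_iSup_of_nonneg (apply_nonneg w c)]
  simp

lemma absNorm_sum_spanSingleton_smul {N : ℕ} (c : K) (x : Fin N → K) :
    FractionalIdeal.absNorm
        (∑ i, FractionalIdeal.spanSingleton (nonZeroDivisors (𝓞 K)) ((c • x) i)) =
      |Algebra.norm ℚ c| * FractionalIdeal.absNorm
        (∑ i, FractionalIdeal.spanSingleton (nonZeroDivisors (𝓞 K)) (x i)) := by
  rw [← FractionalIdeal.absNorm_span_singleton (𝓞 K), ← map_mul, Finset.mul_sum]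
  simp [FractionalIdeal.spanSingleton_mul_spanSingleton]

lemma sum_spanSingleton_algebraMap {N : ℕ} (a : Fin N → 𝓞 K) :
    ∑ i, FractionalIdeal.spanSingleton (nonZeroDivisors (𝓞 K)) (algebraMap (𝓞 K) K (a i)) =
      (Ideal.span (Set.range a) : FractionalIdeal (nonZeroDivisors (𝓞 K)) K) := by
  have h (s : Finset (Fin N)) :
      ∑ i ∈ s, FractionalIdeal.spanSingleton (nonZeroDivisors (𝓞 K)) (algebraMap (𝓞 K) K (a i)) =
        (Ideal.span (a '' s) : FractionalIdeal (nonZeroDivisors (𝓞 K)) K) := by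
    classical
    induction s using Finset.induction_on with
    | empty => simp
    | insert i s hi ih =>
      rw [Finset.sum_insert hi, ih, ← FractionalIdeal.coeIdeal_span_singleton,
        ← FractionalIdeal.coeIdeal_sup, ← Ideal.span_union, Finset.coe_insert, Set.image_insert_eq,
        Set.insert_eq]
  simpa using h Finset.univ

/-- `vecHeight` is the normalized version of the relative height `Height.mulHeight`. -/
lemma vecHeight_eq {N : ℕ} {x : Fin N → K} (hx : x ≠ 0) :
    vecHeight x = Height.mulHeight x ^ ((Module.finrank ℚ K : ℝ)⁻¹) := by
  obtain ⟨b, hb⟩ := IsLocalization.exist_integer_multiples_of_finite (nonZeroDivisors (𝓞 K)) x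
  choose a ha using hb
  set c : K := algebraMap (𝓞 K) K b with hc
  have hc0 : c ≠ 0 := by simp [hc]
  have hcx : c • x = fun i ↦ algebraMap (𝓞 K) K (a i) := by
    ext i
    rw [ha, Pi.smul_apply, smul_eq_mul, hc, ← Algebra.smul_def]
  have ha0 : a ≠ 0 := by
    rintro rfl
    refine smul_ne_zero hc0 hx ?_
    rw [hcx]
    ext
    simp
  have hN : |(Algebra.norm ℚ c : ℝ)| ≠ 0 := by simpa [Algebra.norm_eq_zero_iff] using hc0
  have hI := absNorm_mul_finprod_finitePlace_eq_one ha0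
  have hnorm := absNorm_sum_spanSingleton_smul c x
  have hinf := prod_infinitePlace_iSup_smul c x
  rw [hcx, sum_spanSingleton_algebraMap, FractionalIdeal.coeIdeal_absNorm] at hnorm
  rw [vecHeight, ← Height.mulHeight_smul_eq_mulHeight x hc0,
    NumberField.mulHeight_eq (smul_ne_zero hc0 hx), hinf]
  congr 1
  replace hnorm := congrArg (Rat.cast : ℚ → ℝ) hnorm
  push_cast at hnorm
  have hx' : ∏ᶠ v : FinitePlace K, ⨆ i, v ((c • x) i) =
      (Ideal.absNorm (Ideal.span (Set.range a)) : ℝ)⁻¹ := by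
    rw [hcx]
    exact eq_inv_of_mul_eq_one_right hI
  rw [hx', hnorm, mul_inv]
  field_simp

lemma projHeight_eq {n : ℕ} (x : Projectivization K (Fin (n + 1) → K)) :
    projHeight x = Height.mulHeight x.rep ^ ((Module.finrank ℚ K : ℝ)⁻¹) :=
  vecHeight_eq x.rep_nonzero

lemma projHeight_mk {n : ℕ} {v : Fin (n + 1) → K} (hv : v ≠ 0) :
    projHeight (Projectivization.mk K v hv) =
      Height.mulHeight v ^ ((Module.finrank ℚ K : ℝ)⁻¹) := by
  obtain ⟨a, ha⟩ := Projectivization.exists_smul_eq_mk_rep K v hv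
  rw [projHeight_eq, ← ha, Units.smul_def, Height.mulHeight_smul_eq_mulHeight v a.ne_zero]

/-- The Northcott property of the height on projective space over a number field. -/
lemma finite_projHeight_le (n : ℕ) (B : ℝ) :
    {x : Projectivization K (Fin (n + 1) → K) | projHeight x ≤ B}.Finite := by
  have hcoord (x : Projectivization K (Fin (n + 1) → K)) : ∃ j, x.rep j ≠ 0 :=
    Function.ne_iff.mp x.rep_nonzero
  choose j hj using hcoord
  let g (x : Projectivization K (Fin (n + 1) → K)) : Fin (n + 1) → K := fun i ↦ x.rep i / x.rep (j x)
  have hg : Function.Injective g := by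
    intro x y hxy
    rw [← x.mk_rep, ← y.mk_rep, Projectivization.mk_eq_mk_iff']
    refine ⟨x.rep (j x) / y.rep (j y), funext fun i ↦ ?_⟩
    have := congrFun hxy i
    simp only [g] at this
    have h1 := hj x
    have h2 := hj y
    simp only [Pi.smul_apply, smul_eq_mul]
    field_simp at this ⊢
    linear_combination -this
  have hd : (0 : ℝ) < Module.finrank ℚ K := mod_cast Module.finrank_pos
  refine ((Set.Finite.pi' fun _ : Fin (n + 1) ↦ finite_setOfPred_mulHeight₁_le K
    (B ^ (Module.finrank ℚ K : ℝ))).preimage hg.injOn).subset fun x hx i ↦ ?_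
  simp only [Set.mem_ofPred_eq, projHeight_eq] at hx
  have h1 : Height.mulHeight x.rep ≤ B ^ (Module.finrank ℚ K : ℝ) := by
    rw [← Real.rpow_inv_rpow (Height.mulHeight_pos x.rep).le hd.ne']
    exact Real.rpow_le_rpow (Real.rpow_nonneg (Height.mulHeight_pos x.rep).le _) hx hd.le
  refine le_trans ?_ h1
  rw [Height.mulHeight₁_div_eq_mulHeight]
  have h2 : ![x.rep i, x.rep (j x)] = x.rep ∘ ![i, j x] := by
    ext l
    fin_cases l <;> rfl
  rw [h2]
  exact Height.mulHeight_comp_le ![i, j x] x.rep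

lemma mulHeight₁_natCast_le (a : ℕ) :
    Height.mulHeight₁ (a : K) ≤ (max a 1 : ℝ) ^ Module.finrank ℚ K := by
  rw [NumberField.mulHeight₁_eq, finprod_eq_one_of_forall_eq_one, mul_one,
    ← InfinitePlace.sum_mult_eq, ← Finset.prod_pow_eq_pow_sum]
  · simp
  · intro v
    refine max_eq_right ?_
    have := FinitePlace.norm_le_one K v.maximalIdeal (a : 𝓞 K)
    rwa [FinitePlace.norm_embedding_eq, map_natCast] at this

end Height

/-! ### Counting points on the image of a binary form map -/

lemma eval_smul_of_isHomogeneous {R σ : Type*} [CommSemiring R] {e : ℕ} {f : MvPolynomial σ R}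
    (hf : f.IsHomogeneous e) (c : R) (x : σ → R) : eval (c • x) f = c ^ e * eval x f := by
  rw [eval_eq, eval_eq, Finset.mul_sum]
  refine Finset.sum_congr rfl fun m hm ↦ ?_
  have h := hf.degree_eq_sum_deg_support hm
  simp only [Pi.smul_apply, smul_eq_mul, mul_pow, Finset.prod_mul_distrib, Finset.prod_pow_eq_pow_sum]
  rw [← h]
  ring

/-- Membership in a projective zero locus can be tested on any homogeneous coordinate vector. -/
lemma mk_mem_projZeroLocus_iff {k : Type} [CommRing k] {n : ℕ}
    {S : Set (MvPolynomial (Fin (n + 1)) k)} (hhom : ∀ f ∈ S, ∃ e, f.IsHomogeneous e)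
    {L : Type} [Field L] [Algebra k L] {v : Fin (n + 1) → L} (hv : v ≠ 0) :
    Projectivization.mk L v hv ∈ projZeroLocus k S L ↔
      ∀ f ∈ S, eval v (map (algebraMap k L) f) = 0 := by
  obtain ⟨a, ha⟩ := Projectivization.exists_smul_eq_mk_rep L v hv
  refine forall₂_congr fun f hf ↦ ?_
  obtain ⟨e, he⟩ := hhom f hf
  rw [← ha, Units.smul_def, eval_smul_of_isHomogeneous (he.map _)]
  simp

/-- A tuple of binary forms, restricted to the integral points of an affine chart, takes each
projective value a bounded number of times unless it is constant. -/
lemma exists_card_fiber_le {K : Type} [Field K] [CharZero K] {n d : ℕ}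
    {P : Fin (n + 1) → MvPolynomial (Fin 2) K} (hP : ∀ i, (P i).IsHomogeneous d)
    (hne : ∀ a : ℕ, (fun i ↦ eval ![(a : K), 1] (P i)) ≠ 0)
    (hnc : ∀ a : ℕ, ∃ i j,
      C (eval ![(a : K), 1] (P i)) * P j ≠ C (eval ![(a : K), 1] (P j)) * P i) :
    ∃ D : ℕ, ∀ (s : Finset ℕ) (b : ℕ), (∀ a ∈ s,
      Projectivization.mk K _ (hne a) = Projectivization.mk K _ (hne b)) → s.card ≤ D := by
  classical
  let p (i : Fin (n + 1)) : Polynomial K := aeval ![Polynomial.X, 1] (P i)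
  have hp (i : Fin (n + 1)) (a : K) : (p i).eval a = eval ![a, 1] (P i) := by
    have h (l : Fin 2) :
        Polynomial.aeval a ((![Polynomial.X, 1] : Fin 2 → Polynomial K) l) = ![a, 1] l := by
      fin_cases l <;> simp
    rw [← Polynomial.coe_aeval_eq_eval, comp_aeval_apply]
    simp only [h]
    exact DFunLike.congr_fun (coe_aeval_eq_eval ![a, 1]) (P i)
  refine ⟨Finset.univ.sup fun i ↦ (p i).natDegree, fun s b hs ↦ ?_⟩
  obtain ⟨i, j, hij⟩ := hnc b
  set α := eval ![(b : K), 1] (P i)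
  set β := eval ![(b : K), 1] (P j)
  let q : Polynomial K := Polynomial.C α * p j - Polynomial.C β * p i
  have hq0 : q ≠ 0 := by
    intro h0
    apply hij
    rw [← sub_eq_zero]
    have hhom : (C α * P j - C β * P i).IsHomogeneous d := ((hP j).C_mul α).sub ((hP i).C_mul β)
    rw [← Polynomial.homogenize_eq_of_isHomogeneous hhom (p := 0), Polynomial.homogenize_zero]
    rw [← h0, map_sub, map_mul, map_mul, aeval_C, aeval_C]
    rfl
  have hqdeg : q.natDegree ≤ Finset.univ.sup fun i ↦ (p i).natDegree :=
    (Polynomial.natDegree_sub_le_of_le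
      ((Polynomial.natDegree_C_mul_le _ _).trans
        (Finset.le_sup (f := fun i ↦ (p i).natDegree) (Finset.mem_univ j)))
      ((Polynomial.natDegree_C_mul_le _ _).trans
        (Finset.le_sup (f := fun i ↦ (p i).natDegree) (Finset.mem_univ i)))).trans_eq (max_self _)
  rw [← Finset.card_image_of_injective s (Nat.cast_injective (R := K))]
  refine (Polynomial.card_le_degree_of_subset_roots (p := q) ?_).trans hqdeg
  intro x hx
  simp only [Finset.mem_val, Finset.mem_image] at hx
  obtain ⟨a, ha, rfl⟩ := hx
  rw [Polynomial.mem_roots hq0, Polynomial.IsRoot.def]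
  obtain ⟨u, hu⟩ := (Projectivization.mk_eq_mk_iff' K _ _ _ _).mp (hs a ha)
  have hui := congrFun hu i
  have huj := congrFun hu j
  simp only [Pi.smul_apply, smul_eq_mul] at hui huj
  simp only [q, Polynomial.eval_sub, Polynomial.eval_mul, Polynomial.eval_C, hp]
  rw [← hui, ← huj]
  ring

/-- The heights of the values of a tuple of binary forms at integral points of an affine chart grow
at most polynomially. -/
lemma exists_projHeight_mk_le {K : Type} [Field K] [NumberField K] {n d : ℕ}
    {P : Fin (n + 1) → MvPolynomial (Fin 2) K} (hP : ∀ i, (P i).IsHomogeneous d)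
    (hne : ∀ a : ℕ, (fun i ↦ eval ![(a : K), 1] (P i)) ≠ 0) :
    ∃ B : ℝ, 0 < B ∧ ∀ a : ℕ,
      projHeight (Projectivization.mk K _ (hne a)) ≤ B * (max a 1 : ℝ) ^ d := by
  obtain ⟨B, hB, h⟩ := Height.mulHeight_eval_le' hP
  have hr : (0 : ℝ) < (Module.finrank ℚ K : ℝ)⁻¹ := inv_pos.mpr (mod_cast Module.finrank_pos)
  refine ⟨B ^ (Module.finrank ℚ K : ℝ)⁻¹, Real.rpow_pos_of_pos hB _, fun a ↦ ?_⟩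
  rw [projHeight_mk]
  have h1 : Height.mulHeight ![(a : K), 1] ^ d ≤ ((max a 1 : ℝ) ^ d) ^ Module.finrank ℚ K := by
    rw [← Height.mulHeight₁_eq_mulHeight, pow_right_comm]
    exact pow_le_pow_left₀ (Height.mulHeight₁_nonneg _) (mulHeight₁_natCast_le a) d
  calc _ ≤ (B * ((max a 1 : ℝ) ^ d) ^ Module.finrank ℚ K) ^ (Module.finrank ℚ K : ℝ)⁻¹ := by
        refine Real.rpow_le_rpow (Height.mulHeight_pos _).le ((h _).trans ?_) hr.le
        gcongr
    _ = _ := by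
        rw [Real.mul_rpow hB.le (by positivity), Real.pow_rpow_inv_natCast (by positivity)
          Module.finrank_pos.ne']

/-- A set of projective points containing the values of a non-constant tuple of binary forms has at
least a power of `T` many points of height at most `T`. -/
lemma exists_le_ncard_projHeight_le {K : Type} [Field K] [NumberField K] {n d : ℕ}
    {P : Fin (n + 1) → MvPolynomial (Fin 2) K} (hP : ∀ i, (P i).IsHomogeneous d)
    (hne : ∀ a : ℕ, (fun i ↦ eval ![(a : K), 1] (P i)) ≠ 0)
    (hnc : ∀ a : ℕ, ∃ i j,
      C (eval ![(a : K), 1] (P i)) * P j ≠ C (eval ![(a : K), 1] (P j)) * P i)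
    {X : Set (Projectivization K (Fin (n + 1) → K))}
    (hX : ∀ a : ℕ, Projectivization.mk K _ (hne a) ∈ X) :
    ∃ ε c : ℝ, 0 < ε ∧ 0 < c ∧ ∃ T₀ : ℝ, ∀ T : ℝ, T₀ ≤ T →
      c * T ^ ε ≤ (({x | x ∈ X ∧ projHeight x ≤ T}).ncard : ℝ) := by
  classical
  obtain ⟨B, hB, hheight⟩ := exists_projHeight_mk_le hP hne
  obtain ⟨D, hD⟩ := exists_card_fiber_le hP hne hnc
  set ε : ℝ := ((d + 1 : ℕ) : ℝ)⁻¹ with hε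
  have hε0 : 0 < ε := by positivity
  refine ⟨ε, (B ^ ε)⁻¹ / (2 * (D + 1)), hε0, by positivity, B, fun T hT ↦ ?_⟩
  have hTB : 1 ≤ T / B := (one_le_div hB).mpr hT
  have hroot : 1 ≤ (T / B) ^ ε := Real.one_le_rpow hTB hε0.le
  set M : ℕ := ⌊(T / B) ^ ε⌋₊
  have hM1 : 1 ≤ M := Nat.one_le_floor_iff _ |>.mpr hroot
  have hMle : (M : ℝ) ≤ (T / B) ^ ε := Nat.floor_le (by positivity)
  have hMge : (T / B) ^ ε ≤ 2 * M := by
    have h1 := Nat.lt_floor_add_one ((T / B) ^ ε)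
    have h2 : (1 : ℝ) ≤ M := mod_cast hM1
    linarith
  let f (a : ℕ) : Projectivization K (Fin (n + 1) → K) := Projectivization.mk K _ (hne a)
  have hcard : M ≤ (D + 1) * ((Finset.range M).image f).card := by
    conv_lhs => rw [← Finset.card_range M]
    refine Finset.card_le_mul_card_image _ _ fun z hz ↦ ?_
    obtain ⟨b, -, rfl⟩ := Finset.mem_image.mp hz
    exact (hD _ b fun a ha ↦ (Finset.mem_filter.mp ha).2).trans (Nat.le_succ D)
  have hsub : ((Finset.range M).image f : Set (Projectivization K (Fin (n + 1) → K))) ⊆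
      {x | x ∈ X ∧ projHeight x ≤ T} := by
    intro x hx
    simp only [Finset.coe_image, Set.mem_image, Finset.mem_coe, Finset.mem_range] at hx
    obtain ⟨a, ha, rfl⟩ := hx
    refine ⟨hX a, (hheight a).trans ?_⟩
    have h2 : (1 : ℝ) ≤ M := mod_cast hM1
    have h3 : (max a 1 : ℝ) ≤ M := max_le (mod_cast ha.le) h2
    calc B * (max a 1 : ℝ) ^ d ≤ B * (M : ℝ) ^ (d + 1) := by
          gcongr
          exact (pow_le_pow_left₀ (by positivity) h3 d).trans (pow_le_pow_right₀ h2 d.le_succ)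
      _ ≤ B * ((T / B) ^ ε) ^ (d + 1) := by gcongr
      _ = T := by
          rw [hε, Real.rpow_inv_natCast_pow (by positivity) d.succ_ne_zero]
          field_simp
  have hncard := Set.ncard_le_ncard hsub
    ((finite_projHeight_le n T).subset fun x hx ↦ hx.2)
  rw [Set.ncard_coe_finset] at hncard
  have hfinal : (M : ℝ) ≤ (D + 1) * ({x | x ∈ X ∧ projHeight x ≤ T}.ncard : ℝ) :=
    mod_cast hcard.trans (Nat.mul_le_mul_left _ hncard)
  have hT0 : 0 ≤ T := hB.le.trans hT
  calc (B ^ ε)⁻¹ / (2 * (D + 1)) * T ^ ε = (T / B) ^ ε / (2 * (D + 1)) := by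
        rw [Real.div_rpow hT0 hB.le]
        ring
    _ ≤ _ := by
        rw [div_le_iff₀ (by positivity)]
        linarith

/-! ### Descent to a number field -/

/-- Finitely many polynomials over an algebraic extension are defined over a finite one. -/
lemma exists_finiteDimensional_forall_mem_range_map {k K σ ι : Type*} [Field k] [Field K]
    [Algebra k K] [Algebra.IsAlgebraic k K] [Finite ι] (P : ι → MvPolynomial σ K) :
    ∃ E : IntermediateField k K, FiniteDimensional k E ∧
      ∀ i, ∃ Q : MvPolynomial σ E, map (algebraMap E K) Q = P i := by
  let A : Set K := ⋃ i, ((P i).coeffs : Set K)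
  have : Finite A := Set.finite_iUnion fun i ↦ (P i).coeffs.finite_toSet
  refine ⟨IntermediateField.adjoin k A, IntermediateField.finiteDimensional_adjoin fun x _ ↦
    Algebra.IsIntegral.isIntegral x, fun i ↦ ?_⟩
  refine mem_range_map_iff_coeffs_subset.mpr fun x hx ↦ ?_
  exact ⟨⟨x, IntermediateField.subset_adjoin k A (Set.mem_iUnion_of_mem i hx)⟩, rfl⟩

/-- A non-constant map given by binary forms is not constant in any fixed direction. -/
lemma RatCurveData.exists_C_mul_ne {K : Type} [Field K] {n : ℕ} (Γ : RatCurveData K n)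
    (hne : ∀ s t : K, ¬(s = 0 ∧ t = 0) → Γ.evalAt s t ≠ 0)
    (hnc : ∃ s t s' t' : K, ¬(s = 0 ∧ t = 0) ∧ ¬(s' = 0 ∧ t' = 0) ∧
      ∀ u : K, Γ.evalAt s' t' ≠ u • Γ.evalAt s t) {v : Fin (n + 1) → K} (hv : v ≠ 0) :
    ∃ i j, C (v i) * Γ.P j ≠ C (v j) * Γ.P i := by
  by_contra! h
  obtain ⟨l, hl⟩ := Function.ne_iff.mp hv
  have hmul (s t : K) : Γ.evalAt s t = (Γ.evalAt s t l / v l) • v := by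
    ext j
    have := congrArg (eval ![s, t]) (h l j)
    simp only [map_mul, eval_C] at this
    simp only [RatCurveData.evalAt, Pi.smul_apply, smul_eq_mul]
    simp only [Pi.zero_apply] at hl
    field_simp
    linear_combination this
  obtain ⟨s, t, s', t', hst, -, hu⟩ := hnc
  have h0 : Γ.evalAt s t l / v l ≠ 0 := fun h0 ↦ hne s t hst (by rw [hmul, h0, zero_smul])
  refine hu ((Γ.evalAt s' t' l / v l) / (Γ.evalAt s t l / v l)) ?_
  rw [congrArg (_ • ·) (hmul s t), smul_smul, div_mul_cancel₀ _ h0]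
  exact hmul s' t'

/-- A closed set containing a rational curve over `ℚ̄` has at least a power of `T` many points of
height at most `T` over some finite extension. -/
lemma exists_finiteExtension_le_ncard (k : Type) [Field k] [NumberField k] (n : ℕ)
    (S : Set (MvPolynomial (Fin (n + 1)) k)) (hhom : ∀ f ∈ S, ∃ e, f.IsHomogeneous e)
    (hcurve : ∃ C : Set (Projectivization (AlgebraicClosure k)
        (Fin (n + 1) → AlgebraicClosure k)),
      IsRationalCurve (AlgebraicClosure k) C ∧
        C ⊆ projZeroLocus k S (AlgebraicClosure k)) :
    ∃ (L : FiniteExtensionOf k) (ε c : ℝ), 0 < ε ∧ 0 < c ∧ ∃ T₀ : ℝ, ∀ T : ℝ, T₀ ≤ T →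
      c * T ^ ε ≤
        (({x | x ∈ projZeroLocus k S L.carrier ∧ projHeight x ≤ T}).ncard : ℝ) := by
  obtain ⟨_, ⟨Γ, hne, hnc, rfl⟩, hC⟩ := hcurve
  obtain ⟨E, hE, hQ⟩ := exists_finiteDimensional_forall_mem_range_map (k := k) Γ.P
  choose Q hQ using hQ
  have hinj : Function.Injective (algebraMap E (AlgebraicClosure k)) :=
    (algebraMap E (AlgebraicClosure k)).injective
  have hQhom (i : Fin (n + 1)) : (Q i).IsHomogeneous Γ.d :=
    .of_map hinj (by rw [hQ]; exact Γ.homog i)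
  have heval (a : ℕ) (i : Fin (n + 1)) :
      algebraMap E (AlgebraicClosure k) (eval ![(a : E), 1] (Q i)) = Γ.evalAt a 1 i := by
    have h : ![(a : AlgebraicClosure k), 1] =
        algebraMap E (AlgebraicClosure k) ∘ ![(a : E), 1] := by
      ext l
      fin_cases l <;> simp
    rw [RatCurveData.evalAt, ← hQ, eval_map, h, eval₂_comp]
  have hΓ (a : ℕ) : Γ.evalAt a 1 ≠ 0 := hne _ _ (by simp)
  have hQne (a : ℕ) : (fun i ↦ eval ![(a : E), 1] (Q i)) ≠ 0 := by
    intro h0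
    refine hΓ a (funext fun i ↦ ?_)
    rw [← heval, congrFun h0 i]
    simp
  have : NumberField E := NumberField.of_module_finite k E
  refine ⟨⟨E⟩, exists_le_ncard_projHeight_le hQhom hQne (fun a ↦ ?_) fun a ↦ ?_⟩
  · obtain ⟨i, j, hij⟩ := Γ.exists_C_mul_ne hne hnc (hΓ a)
    refine ⟨i, j, fun h ↦ hij ?_⟩
    simpa only [map_mul, map_C, heval, hQ] using
      congrArg (map (algebraMap E (AlgebraicClosure k))) h
  · rw [mk_mem_projZeroLocus_iff hhom]
    intro f hf
    have hmem := (mk_mem_projZeroLocus_iff hhom (hΓ a)).mp (hC ⟨_, _, hΓ a, rfl⟩) f hf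
    apply hinj
    rw [map_zero, ← hmem, eval_map, eval_map, IsScalarTower.algebraMap_eq k E (AlgebraicClosure k)]
    rw [hom_eval₂]
    congr 1
    exact funext fun i ↦ heval a i

/-- Let `X ⊆ ℙⁿ` be a Zariski closed set defined over a number field `k`
(cut out by a set `S` of homogeneous polynomials).  If `X_ℚ̄` contains a (possibly
singular) rational curve, then `X` is not xeric: there exist a finite extension `L/k`, a
real `ε > 0` and a constant `c > 0` such that `N(X, L, T) ≥ c · T^ε` for all sufficiently
large `T`. -/
theorem statement_2 (k : Type) [Field k] [NumberField k] (n : ℕ)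
    (S : Set (MvPolynomial (Fin (n + 1)) k))
    (hhom : ∀ f ∈ S, ∃ e, f.IsHomogeneous e)
    (hcurve : ∃ C : Set (Projectivization (AlgebraicClosure k)
        (Fin (n + 1) → AlgebraicClosure k)),
      IsRationalCurve (AlgebraicClosure k) C ∧
        C ⊆ projZeroLocus k S (AlgebraicClosure k)) :
    ¬ IsXeric k S ∧
      ∃ (L : FiniteExtensionOf k) (ε c : ℝ), 0 < ε ∧ 0 < c ∧ ∃ T₀ : ℝ, ∀ T : ℝ, T₀ ≤ T →
        c * T ^ ε ≤
          (({x | x ∈ projZeroLocus k S L.carrier ∧ projHeight x ≤ T}).ncard : ℝ) := by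
  obtain ⟨L, ε, c, hε, hc, T₀, hT₀⟩ := exists_finiteExtension_le_ncard k n S hhom hcurve
  refine ⟨fun hxeric ↦ ?_, L, ε, c, hε, hc, T₀, hT₀⟩
  obtain ⟨C, hC, hsparse⟩ := hxeric L.carrier (ε / 2) (half_pos hε)
  have htend := (tendsto_rpow_atTop (half_pos hε)).eventually_gt_atTop (C / c)
  obtain ⟨T, hT, hT1, hTT₀⟩ := (htend.and ((Filter.eventually_ge_atTop (1 : ℝ)).and
    (Filter.eventually_ge_atTop T₀))).exists
  have h := (hT₀ T hTT₀).trans (hsparse T hT1).2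
  have hpos : 0 < T ^ (ε / 2) := Real.rpow_pos_of_pos (by linarith) _
  have hsplit : T ^ ε = T ^ (ε / 2) * T ^ (ε / 2) := by
    rw [← Real.rpow_add (by linarith), add_halves]
  rw [hsplit, ← mul_assoc] at h
  rw [div_lt_iff₀ hc] at hT
  linarith [le_of_mul_le_mul_right h hpos]
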